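/- arXiv:2509.23020 — 10 statements merged into one kernel-verified Lean document; each statement's English description precedes it below -/
import Mathlib

section
/- Let V be a finite nonempty set and E a finite family of nonempty subsets of V (a hypergraph), and assume the hypergraph is connected: any two vertices are joined by a finite sequence of vertices in which each consecutive pair lies in a common hyperedge. Let s : V → {−1, 1}. Then the space of global sections Γ_s := {(x, y) ∈ ℝ^V × ℝ^E : s_v · x_v = y_e whenever v ∈ e} is exactly the one-dimensional subspace spanned by the pair ((s_v)_{v∈V}, (1)_{e∈E}). -/
/-- Let `(V, (mem e)_{e : ι})` be a hypergraph: `V` a finite nonempty vertex set and a finite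
family of nonempty hyperedges `mem e ⊆ V`.  Assume it is connected: any two vertices are
joined by a finite sequence of vertices in which each consecutive pair lies in a common
hyperedge.  For a sign function `s : V → {−1,1}`, the space of global sections
`Γ_s = {(x, y) : s v * x v = y e whenever v ∈ mem e}` of the lying sheaf is exactly the
one-dimensional subspace spanned by the pair `(s, (1)_{e})`. -/
theorem stmt3 {V : Type*} [Fintype V] [Nonempty V] {ι : Type*} [Fintype ι]
    (mem : ι → Set V) (hedge : ∀ e, (mem e).Nonempty)
    (hconn : ∀ u v : V,
      Relation.ReflTransGen (fun a b => ∃ e : ι, a ∈ mem e ∧ b ∈ mem e) u v)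
    (s : V → ℝ) (hs : ∀ v, s v = 1 ∨ s v = -1) :
    {p : (V → ℝ) × (ι → ℝ) | ∀ e : ι, ∀ v ∈ mem e, s v * p.1 v = p.2 e} =
      (Submodule.span ℝ {((s, fun _ => 1) : (V → ℝ) × (ι → ℝ))} :
        Set ((V → ℝ) × (ι → ℝ))) ∧
    Module.finrank ℝ
      (Submodule.span ℝ {((s, fun _ => 1) : (V → ℝ) × (ι → ℝ))}) = 1 := by
  have hsq : ∀ v, s v * s v = 1 := fun v => by rcases hs v with h | h <;> simp [h]
  obtain ⟨v₀⟩ := ‹Nonempty V›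
  constructor
  · ext ⟨x, y⟩
    simp only [Set.mem_ofPred_eq, SetLike.mem_coe, Submodule.mem_span_singleton]
    constructor
    · intro h
      have hconst : ∀ v, s v * x v = s v₀ * x v₀ := fun v => by
        induction hconn v₀ v with
        | refl => rfl
        | tail _ hstep ih =>
          obtain ⟨e, ha, hb⟩ := hstep
          rw [← ih, h e _ ha, h e _ hb]
      refine ⟨s v₀ * x v₀, Prod.ext (funext fun v => ?_) (funext fun e => ?_)⟩
      · simp only [Prod.smul_mk, Pi.smul_apply, smul_eq_mul]
        rw [← hconst v]
        linear_combination x v * hsq v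
      · obtain ⟨v, hv⟩ := hedge e
        simp only [Prod.smul_mk, Pi.smul_apply, smul_eq_mul, mul_one]
        rw [← hconst v, h e v hv]
    · rintro ⟨c, hc⟩ e v -
      obtain ⟨rfl, rfl⟩ := Prod.mk.inj hc
      simp only [Pi.smul_apply, smul_eq_mul]
      linear_combination c * hsq v
  · refine finrank_span_singleton fun h => ?_
    have h₀ : s v₀ = 0 := congrFun (congrArg Prod.fst h) v₀
    simpa [h₀] using hsq v₀
end

section
/- Let G = (V, E) be a finite simple connected graph with |V| ≥ 2, let A ⊆ V be nonempty with complement B := V ∖ A, and assume every vertex of A has a neighbor lying in A. Then there exist positive edge weights w : E → (0, ∞) such that, setting d_v := Σ_{e ∋ v} w_e and y ∈ ℝ^V with y_v := √(d_v): (i) y spans the kernel of the normalized weighted Laplacian L' := I − D^{−1/2} A_w D^{−1/2}, and (ii) y_v > y_u for every v ∈ A and every u ∈ B. Consequently, for every initial condition x₀ with ⟨x₀, y⟩ ≠ 0, the normalized diffusion limit linearly separates A from B. -/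
/-- Maximum principle: on a finite connected graph, a function that is harmonic for positive
edge weights is constant. -/
theorem SimpleGraph.Connected.eq_of_weighted_harmonic {V : Type*} [Fintype V]
    {G : SimpleGraph V} [DecidableRel G.Adj] (hG : G.Connected) {w : V → V → ℝ}
    (hw : ∀ u v, G.Adj u v → 0 < w u v) {z : V → ℝ}
    (hz : ∀ v, ∑ u, (if G.Adj v u then w v u * (z v - z u) else 0) = 0) (u v : V) :
    z u = z v := by
  have := hG.nonempty
  obtain ⟨m, hm⟩ := Finite.exists_max z
  have step : ∀ a b, G.Adj a b → z a = z m → z b = z m := by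
    intro a b hab ha
    have hnn : ∀ c ∈ Finset.univ, 0 ≤ if G.Adj a c then w a c * (z a - z c) else 0 := by
      intro c _
      split_ifs with h
      · exact mul_nonneg (hw a c h).le (by linarith [hm c])
      · exact le_rfl
    have h0 := (Finset.sum_eq_zero_iff_of_nonneg hnn).1 (hz a) b (Finset.mem_univ b)
    rw [if_pos hab] at h0
    rcases mul_eq_zero.1 h0 with h | h
    · exact absurd h (hw a b hab).ne'
    · linarith
  have key : ∀ c, z c = z m := by
    intro c
    obtain ⟨p⟩ := hG.preconnected c m
    induction p with
    | nil => rfl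
    | cons h _ ih => exact step _ _ h.symm (ih hm step)
  rw [key u, key v]

/-- For positive edge weights on a finite connected graph with positive weighted degrees `d`,
the kernel of the normalized weighted Laplacian is spanned by `v ↦ √(d v)`. -/
theorem SimpleGraph.Connected.ker_normalized_laplacian {V : Type*} [Fintype V] [DecidableEq V]
    {G : SimpleGraph V} [DecidableRel G.Adj] (hG : G.Connected) {w : V → V → ℝ}
    (hw : ∀ u v, G.Adj u v → 0 < w u v) {d y : V → ℝ}
    (hd : ∀ v, d v = ∑ u, if G.Adj v u then w v u else 0) (hpos : ∀ v, 0 < d v)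
    (hy : ∀ v, y v = Real.sqrt (d v)) :
    LinearMap.ker (1 - Matrix.of (fun v u =>
      if G.Adj v u then w v u / (Real.sqrt (d v) * Real.sqrt (d u)) else 0)).mulVecLin
      = Submodule.span ℝ {y} := by
  have hypos : ∀ v, 0 < y v := fun v => hy v ▸ Real.sqrt_pos.2 (hpos v)
  have hyy : ∀ v, y v * y v = d v := fun v => by rw [hy, Real.mul_self_sqrt (hpos v).le]
  have hrow : ∀ (z : V → ℝ) (v : V), y v * ((1 - Matrix.of (fun v u =>
      if G.Adj v u then w v u / (Real.sqrt (d v) * Real.sqrt (d u)) else 0)).mulVec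
        (fun u => z u * y u)) v
      = ∑ u, (if G.Adj v u then w v u * (z v - z u) else 0) := by
    intro z v
    rw [Matrix.sub_mulVec, Matrix.one_mulVec, Pi.sub_apply, mul_sub,
      show y v * (z v * y v) = d v * z v by rw [← hyy]; ring, hd v, Finset.sum_mul,
      Matrix.mulVec, dotProduct, Finset.mul_sum, ← Finset.sum_sub_distrib]
    refine Finset.sum_congr rfl fun u _ => ?_
    simp only [Matrix.of_apply]
    split_ifs
    · rw [← hy, ← hy]
      have h1 := (hypos v).ne'
      have h2 := (hypos u).ne'
      field_simp
    · simp
  ext x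
  rw [LinearMap.mem_ker, Matrix.mulVecLin_apply, Submodule.mem_span_singleton]
  constructor
  · intro hx
    have hxz : (fun u => x u / y u * y u) = x :=
      funext fun u => div_mul_cancel₀ _ (hypos u).ne'
    have hc := hG.eq_of_weighted_harmonic hw (z := fun u => x u / y u) fun v => by
      rw [← hrow (fun u => x u / y u) v, hxz, hx, Pi.zero_apply, mul_zero]
    have := hG.nonempty
    obtain ⟨m⟩ := this
    refine ⟨x m / y m, funext fun u => ?_⟩
    rw [Pi.smul_apply, smul_eq_mul, hc m u, div_mul_cancel₀ _ (hypos u).ne']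
  · rintro ⟨c, rfl⟩
    funext v
    have h := hrow (fun _ => c) v
    simp only [sub_self, mul_zero, ite_self, Finset.sum_const_zero] at h
    exact (mul_eq_zero.1 h).resolve_left (hypos v).ne'


/-- Let `G` be a finite simple connected graph with at least two vertices, `A` a nonempty
set of vertices with complement `B`, and suppose every vertex of `A` has a neighbor in `A`.
Then there are positive symmetric edge weights `w` such that, with weighted degrees
`d v = ∑_{u ~ v} w v u`, `y v = √(d v)`, and normalized weighted Laplacian
`L' = I − D^{−1/2} A_w D^{−1/2}`:
(i) `y` spans `ker L'`; (ii) `y v > y u` for all `v ∈ A`, `u ∈ B`; and consequently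
(iii) for every initial condition `x₀` with `⟨x₀, y⟩ ≠ 0`, the normalized diffusion limit
(the projection `(⟨x₀,y⟩/⟨y,y⟩) • y` of `x₀` onto `ker L'`) linearly separates `A`
from `B`. -/
theorem stmt5 {V : Type*} [Fintype V] [DecidableEq V]
    (G : SimpleGraph V) [DecidableRel G.Adj] (hG : G.Connected)
    (hcard : 2 ≤ Fintype.card V)
    (A : Set V) (hA : A.Nonempty)
    (hhom : ∀ v ∈ A, ∃ u ∈ A, G.Adj v u) :
    ∃ w : V → V → ℝ,
      (∀ u v, w u v = w v u) ∧
      (∀ u v, G.Adj u v → 0 < w u v) ∧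
      ∀ (d y : V → ℝ) (L' : Matrix V V ℝ),
        (∀ v, d v = ∑ u, if G.Adj v u then w v u else 0) →
        (∀ v, y v = Real.sqrt (d v)) →
        (L' = 1 - Matrix.of (fun v u =>
          if G.Adj v u then w v u / (Real.sqrt (d v) * Real.sqrt (d u)) else 0)) →
        (LinearMap.ker L'.mulVecLin = Submodule.span ℝ {y}) ∧
        (∀ v ∈ A, ∀ u ∉ A, y u < y v) ∧
        (∀ x₀ : V → ℝ, (∑ v, x₀ v * y v) ≠ 0 →
          ∃ a b : ℝ, ∀ v : V,
            (0 < a * (((∑ u, x₀ u * y u) / (∑ u, y u * y u)) * y v) + b ↔ v ∈ A)) := by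
  classical
  have : Nontrivial V := Fintype.one_lt_card_iff_nontrivial.1 hcard
  set n := (Fintype.card V : ℝ) with hn
  have hn0 : 0 ≤ n := Nat.cast_nonneg _
  have hw : ∀ u v, G.Adj u v → 0 < (if u ∈ A ∧ v ∈ A then n + 1 else 1 : ℝ) := by
    intro u v _
    split_ifs <;> linarith
  refine ⟨fun u v => if u ∈ A ∧ v ∈ A then n + 1 else 1, fun u v => by simp only [and_comm],
    hw, ?_⟩
  intro d y L' hd hy hL
  have hle : ∀ v u, G.Adj v u → (if v ∈ A ∧ u ∈ A then n + 1 else 1 : ℝ) ≤ d v := by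
    intro v u huv
    rw [hd v]
    refine le_trans (le_of_eq (if_pos huv).symm) (Finset.single_le_sum
      (f := fun u => if G.Adj v u then (if v ∈ A ∧ u ∈ A then n + 1 else 1 : ℝ) else 0)
      (fun c _ => ?_) (Finset.mem_univ u))
    split_ifs <;> linarith
  have hpos : ∀ v, 0 < d v := by
    intro v
    obtain ⟨u, hu⟩ := hG.preconnected.exists_adj_of_nontrivial v
    exact (hw v u hu).trans_le (hle v u hu)
  have hyA : ∀ v ∈ A, √n < y v := by
    intro v hv
    obtain ⟨u, hu, huv⟩ := hhom v hv
    have h := hle v u huv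
    rw [if_pos ⟨hv, hu⟩] at h
    rw [hy]
    exact Real.sqrt_lt_sqrt hn0 (by linarith)
  have hyB : ∀ v ∉ A, y v ≤ √n := by
    intro v hv
    rw [hy, hd]
    refine Real.sqrt_le_sqrt ?_
    calc _ ≤ ∑ _u : V, (1 : ℝ) := Finset.sum_le_sum fun u _ => by
            simp only [hv, false_and, if_false]
            split_ifs <;> norm_num
      _ = n := by simp [hn]
  refine ⟨hL ▸ hG.ker_normalized_laplacian hw hd hpos hy,
    fun v hv u hu => (hyB u hu).trans_lt (hyA v hv), fun x₀ hx₀ => ?_⟩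
  have hyy : (∑ u, y u * y u) ≠ 0 := by
    refine (Finset.sum_pos (fun u _ => ?_) Finset.univ_nonempty).ne'
    have := hy u ▸ Real.sqrt_pos.2 (hpos u)
    exact mul_pos this this
  refine ⟨((∑ u, x₀ u * y u) / (∑ u, y u * y u))⁻¹, -√n, fun v => ?_⟩
  rw [inv_mul_cancel_left₀ (div_ne_zero hx₀ hyy), ← sub_eq_add_neg, sub_pos]
  exact ⟨fun h => by_contra fun hv => absurd (hyB v hv) (not_le.2 h), hyA v⟩
end

section
/- Let F be a one-dimensional sheaf with positive edge products on a finite simple graph G = (V,E) in which every vertex lies on some edge and E is nonempty. Let σ be LeakyReLU with slope a ∈ [0,1), applied entrywise, let w₁ ∈ ℝ, and let W₂ ∈ ℝ^{f_in × f_out}. Then for every feature matrix X ∈ ℝ^{V × f_in}, the output Y := σ((I − Δ_F)(w₁ X) W₂) of one sheaf-convolutional layer satisfies E_F(Y) ≤ λ* · w₁² · ‖W₂ᵀ‖² · E_F(X), where λ* := max{(λ − 1)² : λ a nonzero eigenvalue of Δ_F} and ‖·‖ is the spectral (operator) norm. -/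
open Finset

/-- The weighted degree `d v = ∑_{e ∋ v} F_{v,e}²` of a one-dimensional sheaf on a graph,
where `F v u` denotes the restriction value of vertex `v` into the edge `{v, u}`. -/
def sheafDeg {V : Type*} [Fintype V] (G : SimpleGraph V) [DecidableRel G.Adj]
    (F : V → V → ℝ) (v : V) : ℝ :=
  ∑ u, if G.Adj v u then (F v u) ^ 2 else 0

/-- The normalized sheaf Laplacian `Δ_F = D^{−1/2} L_F D^{−1/2}` of a one-dimensional
sheaf on a graph, where `(L_F x)_v = ∑_{e={u,v}} F_{v,e} (F_{v,e} x_v − F_{u,e} x_u)`. -/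
noncomputable def sheafDelta {V : Type*} [Fintype V] [DecidableEq V] (G : SimpleGraph V)
    [DecidableRel G.Adj] (F : V → V → ℝ) : Matrix V V ℝ :=
  Matrix.diagonal (fun v => (Real.sqrt (sheafDeg G F v))⁻¹) *
    Matrix.of (fun v u =>
      if v = u then sheafDeg G F v else if G.Adj v u then -(F v u * F u v) else 0) *
    Matrix.diagonal (fun v => (Real.sqrt (sheafDeg G F v))⁻¹)

/-- The sheaf Dirichlet energy `E_F(X) = (1/2) ∑_{e={u,v}} ‖d_u^{−1/2} F_{u,e} X_u −
d_v^{−1/2} F_{v,e} X_v‖²` of a feature matrix `X ∈ ℝ^{V×f}` (each unordered edge is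
counted twice in the double sum over adjacent ordered pairs, whence the factor 1/4). -/
noncomputable def sheafEnergy {V : Type*} [Fintype V] [DecidableEq V] (G : SimpleGraph V)
    [DecidableRel G.Adj] (F : V → V → ℝ) {f : ℕ} (X : Matrix V (Fin f) ℝ) : ℝ :=
  (1 / 4) * ∑ v, ∑ u ∈ G.neighborFinset v, ∑ j,
    ((F u v / Real.sqrt (sheafDeg G F u)) * X u j
      - (F v u / Real.sqrt (sheafDeg G F v)) * X v j) ^ 2

/-- The positively homogeneous map `t ↦ max t (a * t)` with slope `0 ≤ a ≤ 1` does not increase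
the distance between rescaled points when the two scaling factors have the same sign. -/
lemma sq_leakyRelu_sub_le {a : ℝ} (ha0 : 0 ≤ a) (ha1 : a ≤ 1) {α β : ℝ}
    (h : (0 ≤ α ∧ 0 ≤ β) ∨ (α ≤ 0 ∧ β ≤ 0)) (x y : ℝ) :
    (α * max x (a * x) - β * max y (a * y)) ^ 2 ≤ (α * x - β * y) ^ 2 := by
  have lipschitz (s t : ℝ) : |max s (a * s) - max t (a * t)| ≤ |s - t| := by
    refine (abs_max_sub_max_le_max _ _ _ _).trans (max_le le_rfl ?_)
    rw [← mul_sub, abs_mul, abs_of_nonneg ha0]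
    exact mul_le_of_le_one_left (abs_nonneg _) ha1
  have homogeneous {c : ℝ} (hc : 0 ≤ c) (t : ℝ) :
      c * max t (a * t) = max (c * t) (a * (c * t)) := by
    rw [mul_max_of_nonneg _ _ hc, mul_left_comm]
  rcases h with ⟨hα, hβ⟩ | ⟨hα, hβ⟩
  · rw [sq_le_sq, homogeneous hα, homogeneous hβ]
    exact lipschitz _ _
  · have := lipschitz (-α * x) (-β * y)
    rw [← homogeneous (neg_nonneg.2 hα), ← homogeneous (neg_nonneg.2 hβ)] at this
    linarith [sq_le_sq.2 this]

open Matrix in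
/-- If the nonzero eigenvalues `μ` of a positive semidefinite real matrix `A` satisfy
`(μ - 1) ^ 2 ≤ L`, then applying `1 - A` scales the quadratic form of `A` by at most `L`. -/
lemma Matrix.PosSemidef.dotProduct_mulVec_one_sub_le {n : Type*} [Fintype n] [DecidableEq n]
    {A : Matrix n n ℝ} (hA : A.PosSemidef) {L : ℝ}
    (hL : ∀ μ : ℝ, μ ≠ 0 → (∃ x : n → ℝ, x ≠ 0 ∧ A *ᵥ x = μ • x) → (μ - 1) ^ 2 ≤ L)
    (x : n → ℝ) :
    ((1 - A) *ᵥ x) ⬝ᵥ (A *ᵥ ((1 - A) *ᵥ x)) ≤ L * (x ⬝ᵥ (A *ᵥ x)) := by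
  have hH := hA.isHermitian
  set b := hH.eigenvectorBasis
  set c : n → (n → ℝ) → ℝ := fun i y => (b i : n → ℝ) ⬝ᵥ y
  have parseval (y z : n → ℝ) : y ⬝ᵥ z = ∑ i, c i y * c i z := by
    have := b.sum_inner_mul_inner (WithLp.toLp 2 y) (WithLp.toLp 2 z)
    simp only [EuclideanSpace.inner_eq_star_dotProduct, star_trivial] at this
    rw [dotProduct_comm, ← this]
    exact Finset.sum_congr rfl fun i _ => by simp only [c, dotProduct_comm z]
  have coeff (i : n) (y : n → ℝ) : c i (A *ᵥ y) = hH.eigenvalues i * c i y := by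
    simp only [c]
    rw [dotProduct_mulVec, ← mulVec_transpose, ← conjTranspose_eq_transpose_of_trivial, hH.eq,
      hH.mulVec_eigenvectorBasis, smul_dotProduct, smul_eq_mul]
  have coeff_sub (i : n) (y : n → ℝ) :
      c i ((1 - A) *ᵥ y) = (1 - hH.eigenvalues i) * c i y := by
    rw [sub_mulVec, one_mulVec, sub_mul, one_mul, ← coeff]
    exact dotProduct_sub _ _ _
  rw [parseval, parseval, Finset.mul_sum]
  refine Finset.sum_le_sum fun i _ => ?_
  simp only [coeff, coeff_sub]
  rcases eq_or_ne (hH.eigenvalues i) 0 with h0 | h0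
  · simp [h0]
  · have hbound := hL _ h0 ⟨b i, fun h => b.orthonormal.ne_zero i (by ext j; exact congrFun h j),
      hH.mulVec_eigenvectorBasis i⟩
    have hnonneg : 0 ≤ hH.eigenvalues i * c i x ^ 2 :=
      mul_nonneg (hA.eigenvalues_nonneg i) (sq_nonneg _)
    linarith [mul_le_mul_of_nonneg_right hbound hnonneg]

section Sheaf

variable {V : Type*} [Fintype V] [DecidableEq V] (G : SimpleGraph V) [DecidableRel G.Adj]
  (F : V → V → ℝ)

lemma sheafDelta_mulVec_apply (x : V → ℝ) (v : V) :
    (sheafDelta G F).mulVec x v = ∑ u ∈ G.neighborFinset v,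
      F v u / √(sheafDeg G F v) *
        (F v u / √(sheafDeg G F v) * x v - F u v / √(sheafDeg G F u) * x u) := by
  have entry (u : V) : sheafDelta G F v u * x u =
      (if v = u then (√(sheafDeg G F v))⁻¹ * sheafDeg G F v * (√(sheafDeg G F v))⁻¹ * x v
        else 0) -
      (if G.Adj v u then
        F v u / √(sheafDeg G F v) * (F u v / √(sheafDeg G F u) * x u) else 0) := by
    simp only [sheafDelta, Matrix.mul_diagonal, Matrix.diagonal_mul, Matrix.of_apply]
    by_cases h : v = u
    · subst h
      simp
    · by_cases h' : G.Adj v u <;> simp [h, h', div_eq_mul_inv]; ring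
  rw [G.neighborFinset_eq_filter, Finset.sum_filter]
  simp only [Matrix.mulVec, dotProduct, entry, Finset.sum_sub_distrib, Finset.sum_ite_eq,
    Finset.mem_univ, if_true]
  nth_rewrite 2 [sheafDeg]
  rw [Finset.mul_sum, Finset.sum_mul, Finset.sum_mul, ← Finset.sum_sub_distrib]
  refine Finset.sum_congr rfl fun u _ => ?_
  split_ifs <;> ring

/-- The quadratic form of the normalized sheaf Laplacian as a sum over adjacent pairs. -/
lemma dotProduct_sheafDelta_mulVec (x : V → ℝ) :
    x ⬝ᵥ (sheafDelta G F).mulVec x = (1 / 2) * ∑ v, ∑ u ∈ G.neighborFinset v,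
      (F u v / √(sheafDeg G F u) * x u - F v u / √(sheafDeg G F v) * x v) ^ 2 := by
  have swap (f : V → V → ℝ) : ∑ v, ∑ u ∈ G.neighborFinset v, f v u =
      ∑ v, ∑ u ∈ G.neighborFinset v, f u v :=
    Finset.sum_comm' fun v u => by simp [G.adj_comm]
  simp only [dotProduct, sheafDelta_mulVec_apply, Finset.mul_sum (G.neighborFinset _)]
  rw [eq_comm, one_div, inv_mul_eq_iff_eq_mul₀ two_ne_zero, two_mul]
  nth_rewrite 2 [swap]
  simp only [← Finset.sum_add_distrib]
  exact Finset.sum_congr rfl fun v _ => Finset.sum_congr rfl fun u _ => by ring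

lemma sheafEnergy_eq_sum_dotProduct {f : ℕ} (X : Matrix V (Fin f) ℝ) :
    sheafEnergy G F X =
      (1 / 2) * ∑ j, (X.col j) ⬝ᵥ (sheafDelta G F).mulVec (X.col j) := by
  simp only [dotProduct_sheafDelta_mulVec, ← Finset.mul_sum, Matrix.col_apply]
  rw [Finset.sum_comm, sheafEnergy, ← mul_assoc]
  norm_num
  refine Finset.sum_congr rfl fun v _ => Finset.sum_comm

lemma posSemidef_sheafDelta : (sheafDelta G F).PosSemidef := by
  refine Matrix.PosSemidef.of_dotProduct_mulVec_nonneg ?_ fun x => ?_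
  · refine Matrix.IsHermitian.ext fun v u => ?_
    simp only [sheafDelta, Matrix.mul_diagonal, Matrix.diagonal_mul, Matrix.of_apply,
      star_trivial, G.adj_comm u v, eq_comm (a := u)]
    split_ifs with h
    · rw [h]
    · ring
    · ring
  · rw [star_trivial, dotProduct_sheafDelta_mulVec]
    positivity

lemma sheafEnergy_smul {f : ℕ} (w : ℝ) (X : Matrix V (Fin f) ℝ) :
    sheafEnergy G F (w • X) = w ^ 2 * sheafEnergy G F X := by
  simp only [sheafEnergy, Matrix.smul_apply, smul_eq_mul, Finset.mul_sum]
  exact Finset.sum_congr rfl fun v _ => Finset.sum_congr rfl fun u _ =>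
    Finset.sum_congr rfl fun j _ => by ring

lemma sheafEnergy_one_sub_sheafDelta_mul_le {f : ℕ} (X : Matrix V (Fin f) ℝ) {L : ℝ}
    (hL : ∀ μ : ℝ, μ ≠ 0 →
      (∃ x : V → ℝ, x ≠ 0 ∧ (sheafDelta G F).mulVec x = μ • x) → (μ - 1) ^ 2 ≤ L) :
    sheafEnergy G F ((1 - sheafDelta G F) * X) ≤ L * sheafEnergy G F X := by
  rw [sheafEnergy_eq_sum_dotProduct, sheafEnergy_eq_sum_dotProduct, mul_left_comm,
    Finset.mul_sum (a := L)]
  gcongr with j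
  exact (posSemidef_sheafDelta G F).dotProduct_mulVec_one_sub_le hL (X.col j)

lemma sheafEnergy_mul_le {fi fo : ℕ} (X : Matrix V (Fin fi) ℝ) (W : Matrix (Fin fi) (Fin fo) ℝ)
    {C : ℝ} (hC : ∀ y : Fin fi → ℝ, ∑ i, (W.transpose.mulVec y i) ^ 2 ≤ C * ∑ i, (y i) ^ 2) :
    sheafEnergy G F (X * W) ≤ C * sheafEnergy G F X := by
  rw [sheafEnergy, sheafEnergy, mul_left_comm, Finset.mul_sum (a := C)]
  gcongr with v
  rw [Finset.mul_sum]
  gcongr with u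
  refine le_trans (le_of_eq (Finset.sum_congr rfl fun j _ => ?_)) (hC _)
  simp only [Matrix.mul_apply, Matrix.mulVec, dotProduct, Matrix.transpose_apply,
    Finset.mul_sum, ← Finset.sum_sub_distrib]
  congr 1
  exact Finset.sum_congr rfl fun i _ => by ring

lemma sheafEnergy_leakyRelu_le (hpos : ∀ u v : V, G.Adj u v → 0 < F u v * F v u)
    {a : ℝ} (ha0 : 0 ≤ a) (ha1 : a ≤ 1) {f : ℕ} (X : Matrix V (Fin f) ℝ) :
    sheafEnergy G F (Matrix.of fun v j => max (X v j) (a * X v j)) ≤ sheafEnergy G F X := by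
  unfold sheafEnergy
  refine mul_le_mul_of_nonneg_left (Finset.sum_le_sum fun v _ => Finset.sum_le_sum fun u hu =>
    Finset.sum_le_sum fun j _ => ?_) (by norm_num)
  refine sq_leakyRelu_sub_le ha0 ha1 ?_ _ _
  have hvu := hpos v u ((G.mem_neighborFinset v u).1 hu)
  rcases pos_and_pos_or_neg_and_neg_of_mul_pos hvu with ⟨h₁, h₂⟩ | ⟨h₁, h₂⟩
  · exact Or.inl ⟨div_nonneg h₂.le (Real.sqrt_nonneg _), div_nonneg h₁.le (Real.sqrt_nonneg _)⟩
  · exact Or.inr ⟨div_nonpos_of_nonpos_of_nonneg h₂.le (Real.sqrt_nonneg _),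
      div_nonpos_of_nonpos_of_nonneg h₁.le (Real.sqrt_nonneg _)⟩

end Sheaf

/-- One layer of sheaf convolution `Y = σ((I − Δ_F)(w₁ X) W₂)` with LeakyReLU `σ` of slope
`a ∈ [0,1)` decreases the sheaf Dirichlet energy by the factor
`λ* · w₁² · ‖W₂ᵀ‖²`, where `λ* = max {(λ−1)² : λ a nonzero eigenvalue of Δ_F}` and
`‖W₂ᵀ‖` is the spectral norm (characterized here by `IsLeast`), for any one-dimensional
sheaf `F` with positive edge products on a finite simple graph in which every vertex lies
on some edge and the edge set is nonempty. -/
theorem stmt7 {V : Type*} [Fintype V] [DecidableEq V]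
    (G : SimpleGraph V) [DecidableRel G.Adj] (F : V → V → ℝ)
    (hvert : ∀ v : V, ∃ u, G.Adj v u)
    (hE : G.edgeSet.Nonempty)
    (hpos : ∀ u v : V, G.Adj u v → 0 < F u v * F v u)
    (a : ℝ) (ha0 : 0 ≤ a) (ha1 : a < 1)
    (w₁ : ℝ) {fi fo : ℕ} (W₂ : Matrix (Fin fi) (Fin fo) ℝ)
    (X : Matrix V (Fin fi) ℝ)
    (lamStar : ℝ)
    (hlam : IsGreatest {t : ℝ | ∃ μ : ℝ, μ ≠ 0 ∧
      (∃ x : V → ℝ, x ≠ 0 ∧ (sheafDelta G F).mulVec x = μ • x) ∧ t = (μ - 1) ^ 2} lamStar)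
    (opNS : ℝ)
    (hop : IsLeast {C : ℝ | 0 ≤ C ∧ ∀ y : Fin fi → ℝ,
      ∑ i, (W₂.transpose.mulVec y i) ^ 2 ≤ C * ∑ i, (y i) ^ 2} opNS)
    (Y : Matrix V (Fin fo) ℝ)
    (hY : Y = Matrix.of fun v j =>
      max ((((1 : Matrix V V ℝ) - sheafDelta G F) * (w₁ • X) * W₂) v j)
          (a * ((((1 : Matrix V V ℝ) - sheafDelta G F) * (w₁ • X) * W₂) v j))) :
    sheafEnergy G F Y ≤ lamStar * w₁ ^ 2 * opNS * sheafEnergy G F X := by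
  have hL : ∀ μ : ℝ, μ ≠ 0 →
      (∃ x : V → ℝ, x ≠ 0 ∧ (sheafDelta G F).mulVec x = μ • x) → (μ - 1) ^ 2 ≤ lamStar :=
    fun μ hμ hx => hlam.2 ⟨μ, hμ, hx, rfl⟩
  obtain ⟨hop0, hopW⟩ := hop.1
  subst hY
  calc _ ≤ sheafEnergy G F ((1 - sheafDelta G F) * (w₁ • X) * W₂) :=
        sheafEnergy_leakyRelu_le G F hpos ha0 ha1.le _
    _ ≤ opNS * sheafEnergy G F ((1 - sheafDelta G F) * (w₁ • X)) :=
        sheafEnergy_mul_le G F _ W₂ hopW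
    _ ≤ opNS * (lamStar * sheafEnergy G F (w₁ • X)) := by
        gcongr
        exact sheafEnergy_one_sub_sheafDelta_mul_le G F _ hL
    _ = lamStar * w₁ ^ 2 * opNS * sheafEnergy G F X := by
        rw [sheafEnergy_smul]
        ring
end

section
/- Let F be a one-dimensional sheaf with positive edge products on a finite simple graph G = (V,E) in which every vertex lies on some edge, and let σ be LeakyReLU with slope a ∈ [0,1), applied entrywise. Then for every feature matrix X ∈ ℝ^{V × f}, the sheaf Dirichlet energy does not increase under σ: E_F(σ(X)) ≤ E_F(X). -/
open Finset

/-- LeakyReLU does not increase the squared difference of two reals scaled by weights of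
the same sign. -/
theorem sq_sub_leakyReLU_le {a p q : ℝ} (ha0 : 0 ≤ a) (ha1 : a ≤ 1) (hpq : 0 ≤ p * q)
    (x y : ℝ) :
    (p * max x (a * x) - q * max y (a * y)) ^ 2 ≤ (p * x - q * y) ^ 2 := by
  have max_of_nonneg {t : ℝ} (ht : 0 ≤ t) : max t (a * t) = t :=
    max_eq_left (mul_le_of_le_one_left ht ha1)
  have max_of_nonpos {t : ℝ} (ht : t ≤ 0) : max t (a * t) = a * t :=
    max_eq_right (by nlinarith)
  have hsub : 0 ≤ 1 - a := sub_nonneg.2 ha1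
  have hsq : 0 ≤ 1 - a ^ 2 := by nlinarith
  rcases le_total 0 x with hx | hx <;> rcases le_total 0 y with hy | hy
  · rw [max_of_nonneg hx, max_of_nonneg hy]
  · rw [max_of_nonneg hx, max_of_nonpos hy]
    have hcross := mul_nonneg hsub (mul_nonneg hpq (mul_nonneg hx (neg_nonneg.2 hy)))
    linarith [mul_nonneg hsq (sq_nonneg (q * y))]
  · rw [max_of_nonpos hx, max_of_nonneg hy]
    have hcross := mul_nonneg hsub (mul_nonneg hpq (mul_nonneg (neg_nonneg.2 hx) hy))
    linarith [mul_nonneg hsq (sq_nonneg (p * x))]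
  · rw [max_of_nonpos hx, max_of_nonpos hy]
    linarith [mul_nonneg hsq (sq_nonneg (p * x - q * y))]

/-- For a one-dimensional sheaf `F` with positive edge products on a finite simple graph
in which every vertex lies on some edge, and LeakyReLU `σ` of slope `a ∈ [0,1)` applied
entrywise, the sheaf Dirichlet energy does not increase: `E_F(σ(X)) ≤ E_F(X)`. -/
theorem stmt8 {V : Type*} [Fintype V] [DecidableEq V]
    (G : SimpleGraph V) [DecidableRel G.Adj] (F : V → V → ℝ)
    (hvert : ∀ v : V, ∃ u, G.Adj v u)
    (hpos : ∀ u v : V, G.Adj u v → 0 < F u v * F v u)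
    (a : ℝ) (ha0 : 0 ≤ a) (ha1 : a < 1)
    {f : ℕ} (X : Matrix V (Fin f) ℝ) :
    sheafEnergy G F (Matrix.of fun v j => max (X v j) (a * X v j)) ≤
      sheafEnergy G F X := by
  unfold sheafEnergy
  simp only [Matrix.of_apply]
  refine mul_le_mul_of_nonneg_left ?_ (by norm_num)
  refine sum_le_sum fun v _ => sum_le_sum fun u hu => sum_le_sum fun j _ => ?_
  refine sq_sub_leakyReLU_le ha0 ha1.le ?_ _ _
  rw [div_mul_div_comm]
  have hadj : G.Adj v u := (G.mem_neighborFinset v u).1 hu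
  exact div_nonneg (hpos u v hadj.symm).le (by positivity)
end

section
/- Let Δ be a nonzero symmetric positive semidefinite real n×n matrix all of whose eigenvalues are at most 2, let λ* := max{(λ − 1)² : λ a nonzero eigenvalue of Δ}, and let P := I − Δ. Then for every x ∈ ℝⁿ, ⟨P x, Δ (P x)⟩ ≤ λ* · ⟨x, Δ x⟩. -/
open Matrix in
/-- If `c` dominates `(μ - 1)²` on the nonzero eigenvalues `μ` of a positive semidefinite real
matrix `A`, then `(1 - A) A (1 - A) ≤ c A` in the Loewner order. -/
theorem Matrix.PosSemidef.smul_sub_one_sub_mul_mul_one_sub {ι : Type*} [Fintype ι] [DecidableEq ι]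
    {A : Matrix ι ι ℝ} (hA : A.PosSemidef) {c : ℝ}
    (hc : ∀ i, hA.isHermitian.eigenvalues i ≠ 0 → (hA.isHermitian.eigenvalues i - 1) ^ 2 ≤ c) :
    (c • A - (1 - A) * A * (1 - A)).PosSemidef := by
  set d := hA.isHermitian.eigenvalues
  set φ := Unitary.conjStarAlgAut ℝ (Matrix ι ι ℝ) hA.isHermitian.eigenvectorUnitary with hφ
  have hspec : A = φ (diagonal d) := hA.isHermitian.spectral_theorem
  have hdiag : c • diagonal d - (1 - diagonal d) * diagonal d * (1 - diagonal d) =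
      diagonal fun i => c * d i - (1 - d i) * d i * (1 - d i) := by
    rw [← diagonal_one, diagonal_sub, diagonal_mul_diagonal, diagonal_mul_diagonal,
      ← diagonal_smul, diagonal_sub]
    rfl
  have hM : c • A - (1 - A) * A * (1 - A) =
      φ (diagonal fun i => c * d i - (1 - d i) * d i * (1 - d i)) := by
    rw [← hdiag, map_sub, map_smul, map_mul, map_mul, map_sub, map_one, ← hspec]
  rw [hM, hφ, Unitary.conjStarAlgAut_apply]
  refine PosSemidef.mul_mul_conjTranspose_same (PosSemidef.diagonal fun i => ?_) _
  have h0 : 0 ≤ d i := hA.eigenvalues_nonneg i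
  by_cases h : d i = 0
  · simp [h]
  · have := mul_nonneg h0 (sub_nonneg.2 (hc i h))
    simp only [Pi.zero_apply]
    linarith

/-- Let `Δ` be a nonzero symmetric positive semidefinite real `n × n` matrix all of whose
eigenvalues are at most `2`, let `λ* = max {(λ − 1)² : λ a nonzero eigenvalue of Δ}`
(characterized here by `IsGreatest`), and let `P = I − Δ`.  Then for every `x ∈ ℝⁿ`,
`⟨P x, Δ (P x)⟩ ≤ λ* ⟨x, Δ x⟩`. -/
theorem stmt10 {n : ℕ} (Δ : Matrix (Fin n) (Fin n) ℝ)
    (hPSD : Δ.PosSemidef) (hne : Δ ≠ 0)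
    (hb : ∀ (μ : ℝ) (x : Fin n → ℝ), x ≠ 0 → Δ.mulVec x = μ • x → μ ≤ 2)
    (lamStar : ℝ)
    (hlam : IsGreatest {t : ℝ | ∃ μ : ℝ, μ ≠ 0 ∧
      (∃ x : Fin n → ℝ, x ≠ 0 ∧ Δ.mulVec x = μ • x) ∧ t = (μ - 1) ^ 2} lamStar)
    (P : Matrix (Fin n) (Fin n) ℝ) (hP : P = 1 - Δ) :
    ∀ x : Fin n → ℝ,
      ∑ i, P.mulVec x i * Δ.mulVec (P.mulVec x) i ≤
        lamStar * ∑ i, x i * Δ.mulVec x i := by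
  subst hP
  intro x
  have hc : ∀ i, hPSD.isHermitian.eigenvalues i ≠ 0 →
      (hPSD.isHermitian.eigenvalues i - 1) ^ 2 ≤ lamStar := fun i hi =>
    hlam.2 ⟨_, hi, ⟨_, fun h => hPSD.isHermitian.eigenvectorBasis.orthonormal.ne_zero i
      (WithLp.ofLp_injective 2 h), hPSD.isHermitian.mulVec_eigenvectorBasis i⟩, rfl⟩
  have hsymm : (1 - Δ).transpose = 1 - Δ := by
    simpa [Matrix.IsHermitian] using (Matrix.isHermitian_one.sub hPSD.isHermitian :
      (1 - Δ).IsHermitian)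
  have hquad : (1 - Δ).mulVec x ⬝ᵥ Δ.mulVec ((1 - Δ).mulVec x) =
      x ⬝ᵥ ((1 - Δ) * Δ * (1 - Δ)).mulVec x := by
    rw [← Matrix.mulVec_mulVec, ← Matrix.mulVec_mulVec, Matrix.dotProduct_mulVec x (1 - Δ),
      ← Matrix.mulVec_transpose, hsymm]
  have h := (hPSD.smul_sub_one_sub_mul_mul_one_sub hc).dotProduct_mulVec_nonneg x
  rw [star_trivial, Matrix.sub_mulVec, Matrix.smul_mulVec, dotProduct_sub, dotProduct_smul,
    ← hquad, smul_eq_mul] at h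
  exact sub_nonneg.1 h
end

section
/- Let Δ be a nonzero symmetric positive semidefinite real n×n matrix all of whose eigenvalues are at most 2, let λ* := max{(λ − 1)² : λ a nonzero eigenvalue of Δ}, and let P := I − Δ. Then for all matrices X ∈ ℝ^{n×f} and W ∈ ℝ^{f×g}, Tr((P X W)ᵀ Δ (P X W)) ≤ λ* · ‖Wᵀ‖² · Tr(Xᵀ Δ X), where ‖·‖ denotes the spectral (operator) norm. -/
/-- The quadratic form of a diagonal matrix, summed over the columns of `Z`. -/
theorem Matrix.trace_transpose_mul_diagonal_mul {m k : Type*} [Fintype m] [DecidableEq m]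
    [Fintype k] (d : m → ℝ) (Z : Matrix m k ℝ) :
    (Z.transpose * Matrix.diagonal d * Z).trace = ∑ i, d i * ∑ j, Z i j ^ 2 := by
  simp only [Matrix.trace, Matrix.diag_apply,
    Matrix.mul_apply (M := Z.transpose * Matrix.diagonal d), Matrix.mul_diagonal,
    Matrix.transpose_apply, Finset.mul_sum]
  rw [Finset.sum_comm]
  exact Finset.sum_congr rfl fun i _ => Finset.sum_congr rfl fun j _ => by ring

/-- A real Hermitian matrix is orthogonally diagonalized by its eigenvalues. -/
theorem Matrix.IsHermitian.exists_orthogonal_diagonalization {m : Type*} [Fintype m]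
    [DecidableEq m] {A : Matrix m m ℝ} (hA : A.IsHermitian) :
    ∃ U : Matrix m m ℝ, U.transpose * U = 1 ∧
      A = U * Matrix.diagonal hA.eigenvalues * U.transpose := by
  refine ⟨hA.eigenvectorUnitary, ?_, ?_⟩
  · simpa [Matrix.star_eq_conjTranspose] using
      Unitary.coe_star_mul_self hA.eigenvectorUnitary
  · have h := hA.spectral_theorem
    rw [Unitary.conjStarAlgAut_apply] at h
    simpa [Matrix.star_eq_conjTranspose, Function.comp_def] using h

/-- Let `Δ` be a nonzero symmetric positive semidefinite real `n × n` matrix all of whose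
eigenvalues are at most `2`, let `λ* = max {(λ − 1)² : λ a nonzero eigenvalue of Δ}`
(characterized here by `IsGreatest`), and let `P = I − Δ`.  Then for all matrices
`X ∈ ℝ^{n×f}` and `W ∈ ℝ^{f×g}`,
`Tr((P X W)ᵀ Δ (P X W)) ≤ λ* ‖Wᵀ‖² Tr(Xᵀ Δ X)`, where `‖Wᵀ‖` is the spectral norm
(its square characterized here by `IsLeast`). -/
theorem stmt11 {n f g : ℕ} (Δ : Matrix (Fin n) (Fin n) ℝ)
    (hPSD : Δ.PosSemidef) (hne : Δ ≠ 0)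
    (hb : ∀ (μ : ℝ) (x : Fin n → ℝ), x ≠ 0 → Δ.mulVec x = μ • x → μ ≤ 2)
    (lamStar : ℝ)
    (hlam : IsGreatest {t : ℝ | ∃ μ : ℝ, μ ≠ 0 ∧
      (∃ x : Fin n → ℝ, x ≠ 0 ∧ Δ.mulVec x = μ • x) ∧ t = (μ - 1) ^ 2} lamStar)
    (P : Matrix (Fin n) (Fin n) ℝ) (hP : P = 1 - Δ)
    (X : Matrix (Fin n) (Fin f) ℝ) (W : Matrix (Fin f) (Fin g) ℝ)
    (opNS : ℝ)
    (hop : IsLeast {C : ℝ | 0 ≤ C ∧ ∀ y : Fin f → ℝ,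
      ∑ i, (W.transpose.mulVec y i) ^ 2 ≤ C * ∑ i, (y i) ^ 2} opNS) :
    Matrix.trace ((P * X * W).transpose * Δ * (P * X * W)) ≤
      lamStar * opNS * Matrix.trace (X.transpose * Δ * X) := by
  obtain ⟨U, hU, hΔ⟩ := hPSD.isHermitian.exists_orthogonal_diagonalization
  set d := hPSD.isHermitian.eigenvalues
  have hd_nonneg : ∀ i, 0 ≤ d i := hPSD.eigenvalues_nonneg
  have hd_le : ∀ i, d i ≠ 0 → (d i - 1) ^ 2 ≤ lamStar := fun i hi =>
    hlam.2 ⟨d i, hi, ⟨(hPSD.isHermitian.eigenvectorBasis i).ofLp,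
      fun h => hPSD.isHermitian.eigenvectorBasis.orthonormal.ne_zero i
        ((WithLp.ofLp_eq_zero 2).1 h),
      hPSD.isHermitian.mulVec_eigenvectorBasis i⟩, rfl⟩
  obtain ⟨⟨hop_nonneg, hop_bound⟩, -⟩ := hop
  have htrace : ∀ {k : ℕ} (Y : Matrix (Fin n) (Fin k) ℝ),
      (Y.transpose * Δ * Y).trace = ∑ i, d i * ∑ j, (U.transpose * Y) i j ^ 2 := by
    intro k Y
    rw [← Matrix.trace_transpose_mul_diagonal_mul, hΔ]
    simp only [Matrix.transpose_mul, Matrix.transpose_transpose, Matrix.mul_assoc]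
  have hUP : U.transpose * P = Matrix.diagonal (fun i => 1 - d i) * U.transpose := by
    have hdiag : Matrix.diagonal (fun i => 1 - d i) = 1 - Matrix.diagonal d := by
      rw [← Matrix.diagonal_one, Matrix.diagonal_sub]
    rw [hP, hdiag, mul_sub, sub_mul, mul_one, one_mul, hΔ, ← mul_assoc, ← mul_assoc, hU, one_mul]
  rw [htrace, htrace, Finset.mul_sum]
  refine Finset.sum_le_sum fun i _ => ?_
  have hrow : ∀ j, (U.transpose * (P * X * W)) i j =
      (1 - d i) * W.transpose.mulVec ((U.transpose * X) i) j := by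
    intro j
    rw [← Matrix.mul_assoc, ← Matrix.mul_assoc, hUP, Matrix.mul_assoc, Matrix.mul_assoc,
      Matrix.diagonal_mul, ← Matrix.mul_assoc, Matrix.mulVec_transpose]
    rfl
  simp only [hrow, mul_pow, ← Finset.mul_sum]
  rcases eq_or_ne (d i) 0 with h0 | h0
  · simp [h0]
  have hlam_i : (1 - d i) ^ 2 ≤ lamStar := by
    rw [sub_sq_comm]
    exact hd_le i h0
  calc d i * ((1 - d i) ^ 2 * ∑ j, W.transpose.mulVec ((U.transpose * X) i) j ^ 2)
      ≤ d i * (lamStar * (opNS * ∑ j, (U.transpose * X) i j ^ 2)) := by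
        refine mul_le_mul_of_nonneg_left ?_ (hd_nonneg i)
        exact mul_le_mul hlam_i (hop_bound _) (Finset.sum_nonneg fun _ _ => sq_nonneg _)
          ((sq_nonneg _).trans hlam_i)
    _ = lamStar * opNS * (d i * ∑ j, (U.transpose * X) i j ^ 2) := by ring
end

section
/- Let A, B be finite sets, R ⊆ A × B a relation such that every b ∈ B is related to at least one a ∈ A, with finite-dimensional real inner product spaces U_a, W_b and linear maps F_{ab} : U_a → W_b for (a,b) ∈ R, and let L be the sheaf hypergraph Laplacian of Duta et al. on ⊕_{a∈A} U_a. Then x ∈ ker L if and only if F_{ab} x_a = F_{a'b} x_{a'} for every b ∈ B and all a, a' ∈ A with (a,b) ∈ R and (a',b) ∈ R. -/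
open Finset

/-- Pairing a finite family with its sums of differences gives half the total squared distance. -/
theorem sum_inner_sum_sub {ι E : Type*} [NormedAddCommGroup E] [InnerProductSpace ℝ E]
    (s : Finset ι) (w : ι → E) :
    ∑ i ∈ s, inner ℝ (∑ j ∈ s, (w i - w j)) (w i) =
      2⁻¹ * ∑ i ∈ s, ∑ j ∈ s, ‖w i - w j‖ ^ 2 := by
  have hsymm : ∑ i ∈ s, ∑ j ∈ s, inner ℝ (w i - w j) (w i) =
      -∑ i ∈ s, ∑ j ∈ s, inner ℝ (w i - w j) (w j) := by
    rw [Finset.sum_comm]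
    simp only [← Finset.sum_neg_distrib, ← inner_neg_left, neg_sub]
  have hsq : ∑ i ∈ s, ∑ j ∈ s, ‖w i - w j‖ ^ 2 =
      ∑ i ∈ s, ∑ j ∈ s, inner ℝ (w i - w j) (w i) -
        ∑ i ∈ s, ∑ j ∈ s, inner ℝ (w i - w j) (w j) := by
    simp only [← Finset.sum_sub_distrib, ← inner_sub_right, real_inner_self_eq_norm_sq]
  simp only [sum_inner]
  linarith

/-- Let `R ⊆ A × B` be a finite relation (a hypergraph with node set `A` and nonempty
hyperedges `b ∈ B`), with finite-dimensional real inner product stalks `U a`, `W b` and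
restriction maps `F a b : U a →ₗ[ℝ] W b`, and let `L` be the sheaf hypergraph Laplacian
of Duta et al. on `⊕_{a} U a`:
`(L x) a = ∑_{b : R a b} δ_b⁻¹ • (F a b)* (∑_{a' ≠ a, R a' b} (F a b (x a) − F a' b (x a')))`.
Then `x ∈ ker L` iff `F a b (x a) = F a' b (x a')` for every `b` and all `a, a'`
related to `b`. -/
theorem stmt12 {A B : Type*} [Fintype A] [Fintype B] [DecidableEq A]
    (R : A → B → Prop) [∀ a b, Decidable (R a b)]
    (hB : ∀ b : B, ∃ a : A, R a b)
    (U : A → Type*) [∀ a, NormedAddCommGroup (U a)] [∀ a, InnerProductSpace ℝ (U a)]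
    [∀ a, FiniteDimensional ℝ (U a)]
    (W : B → Type*) [∀ b, NormedAddCommGroup (W b)] [∀ b, InnerProductSpace ℝ (W b)]
    [∀ b, FiniteDimensional ℝ (W b)]
    (F : ∀ a b, U a →ₗ[ℝ] W b)
    (L : (∀ a, U a) → (∀ a, U a))
    (hL : ∀ (x : ∀ a, U a) (a : A), L x a =
      ∑ b ∈ univ.filter (fun b => R a b),
        ((univ.filter (fun a' => R a' b)).card : ℝ)⁻¹ •
          (LinearMap.adjoint (F a b))
            (∑ a' ∈ univ.filter (fun a' => R a' b ∧ a' ≠ a),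
              (F a b (x a) - F a' b (x a')))) :
    ∀ x : ∀ a, U a, L x = 0 ↔
      ∀ (b : B) (a a' : A), R a b → R a' b → F a b (x a) = F a' b (x a') := by
  intro x
  constructor
  · intro hx
    have hdiag : ∀ a b, ∑ a' ∈ univ.filter (fun a' => R a' b ∧ a' ≠ a),
        (F a b (x a) - F a' b (x a')) =
        ∑ a' ∈ univ.filter (fun a' => R a' b), (F a b (x a) - F a' b (x a')) := by
      intro a b
      refine Finset.sum_subset (fun a' => by simp +contextual) fun a' h h' => ?_
      obtain rfl : a' = a := by simpa [(Finset.mem_filter.1 h).2] using h'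
      exact sub_self _
    have henergy : ∑ b, ((univ.filter (fun a => R a b)).card : ℝ)⁻¹ *
        (2⁻¹ * ∑ a ∈ univ.filter (fun a => R a b), ∑ a' ∈ univ.filter (fun a' => R a' b),
          ‖F a b (x a) - F a' b (x a')‖ ^ 2) = 0 := by
      have h : ∑ a, inner ℝ (L x a) (x a) = 0 := by simp [hx]
      simp only [hL, hdiag, sum_inner, real_inner_smul_left, LinearMap.adjoint_inner_left] at h
      rw [Finset.sum_comm' (t' := univ) (s' := fun b => univ.filter (fun a => R a b))
        (by simp)] at h
      rw [← h]
      refine Finset.sum_congr rfl fun b _ => ?_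
      rw [← Finset.mul_sum, ← sum_inner_sum_sub _ (fun a => F a b (x a))]
      simp only [sum_inner]
    intro b a a' ha ha'
    have hb := (Finset.sum_eq_zero_iff_of_nonneg fun b _ => by positivity).1 henergy b
      (Finset.mem_univ b)
    have hcard : ((univ.filter (fun a => R a b)).card : ℝ)⁻¹ ≠ 0 :=
      inv_ne_zero (Nat.cast_ne_zero.2 (Finset.card_ne_zero_of_mem (a := a) (by simpa using ha)))
    have hsum := (mul_eq_zero.1 ((mul_eq_zero.1 hb).resolve_left hcard)).resolve_left
      (by norm_num)
    have hrow := (Finset.sum_eq_zero_iff_of_nonneg fun a _ => by positivity).1 hsum a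
      (by simpa using ha)
    have hterm := (Finset.sum_eq_zero_iff_of_nonneg fun a' _ => by positivity).1 hrow a'
      (by simpa using ha')
    exact sub_eq_zero.1 (norm_eq_zero.1 (pow_eq_zero_iff two_ne_zero |>.1 hterm))
  · intro h
    funext a
    rw [hL, Pi.zero_apply]
    refine Finset.sum_eq_zero fun b hb => ?_
    rw [Finset.sum_eq_zero, map_zero, smul_zero]
    intro a' ha'
    exact sub_eq_zero.2 (h b a a' (Finset.mem_filter.1 hb).2 (Finset.mem_filter.1 ha').2.1)
end

section
/- Let A, B be finite sets, R ⊆ A × B a relation such that every b ∈ B is related to at least one a ∈ A, with finite-dimensional real inner product spaces U_a, W_b and linear maps F_{ab} : U_a → W_b for (a,b) ∈ R, and let L be the sheaf hypergraph Laplacian of Duta et al. on ⊕_{a∈A} U_a. Let Γ := {(x, y) ∈ (⊕_{a∈A} U_a) ⊕ (⊕_{b∈B} W_b) : F_{ab} x_a = y_b for all (a,b) ∈ R} be the space of global sections. Then the map sending x ∈ ker L to (x, y), where y_b is the common value F_{ab} x_a for any a with (a,b) ∈ R, is a well-defined linear isomorphism from ker L onto Γ; its inverse is the restriction to Γ of the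 coordinate projection onto ⊕_{a∈A} U_a. -/
open Finset

theorem sum_inner_sub_eq_half_sum_norm_sub_sq {ι E : Type*} [NormedAddCommGroup E]
    [InnerProductSpace ℝ E] (s : Finset ι) (v : ι → E) :
    ∑ i ∈ s, ∑ j ∈ s, inner ℝ (v i) (v i - v j) =
      2⁻¹ * ∑ i ∈ s, ∑ j ∈ s, ‖v i - v j‖ ^ 2 := by
  have hcomm : ∑ i ∈ s, ∑ j ∈ s, inner ℝ (v i) (v i - v j) =
      ∑ i ∈ s, ∑ j ∈ s, inner ℝ (v j) (v j - v i) := sum_comm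
  have hadd : ∑ i ∈ s, ∑ j ∈ s, ‖v i - v j‖ ^ 2 =
      ∑ i ∈ s, ∑ j ∈ s, inner ℝ (v i) (v i - v j) +
        ∑ i ∈ s, ∑ j ∈ s, inner ℝ (v j) (v j - v i) := by
    simp only [← sum_add_distrib]
    refine sum_congr rfl fun i _ => sum_congr rfl fun j _ => ?_
    rw [← real_inner_self_eq_norm_sq, inner_sub_left, ← neg_sub (v i) (v j), inner_neg_right]
    ring
  rw [hadd, ← hcomm]
  ring

/-- The energy identity for the sheaf hypergraph Laplacian. -/
theorem sum_inner_sheafHypergraphLaplacian {A B : Type*} [Fintype A] [Fintype B] [DecidableEq A]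
    (R : A → B → Prop) [∀ a b, Decidable (R a b)]
    (U : A → Type*) [∀ a, NormedAddCommGroup (U a)] [∀ a, InnerProductSpace ℝ (U a)]
    [∀ a, FiniteDimensional ℝ (U a)]
    (W : B → Type*) [∀ b, NormedAddCommGroup (W b)] [∀ b, InnerProductSpace ℝ (W b)]
    [∀ b, FiniteDimensional ℝ (W b)]
    (F : ∀ a b, U a →ₗ[ℝ] W b) (x : ∀ a, U a) :
    ∑ a, inner ℝ (x a) (∑ b ∈ univ.filter (fun b => R a b),
        ((univ.filter (fun a' => R a' b)).card : ℝ)⁻¹ •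
          (LinearMap.adjoint (F a b))
            (∑ a' ∈ univ.filter (fun a' => R a' b ∧ a' ≠ a),
              (F a b (x a) - F a' b (x a')))) =
      ∑ b, ((univ.filter (fun a => R a b)).card : ℝ)⁻¹ *
        (2⁻¹ * ∑ a ∈ univ.filter (fun a => R a b), ∑ a' ∈ univ.filter (fun a' => R a' b),
          ‖F a b (x a) - F a' b (x a')‖ ^ 2) := by
  have hdiag (a : A) (b : B) :
      ∑ a' ∈ univ.filter (fun a' => R a' b ∧ a' ≠ a), (F a b (x a) - F a' b (x a')) =
        ∑ a' ∈ univ.filter (fun a' => R a' b), (F a b (x a) - F a' b (x a')) := by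
    rw [← filter_filter]
    refine sum_filter_of_ne fun a' _ hne heq => hne ?_
    subst heq
    exact sub_self _
  simp only [hdiag, inner_sum, inner_smul_right, LinearMap.adjoint_inner_right]
  rw [sum_comm' (t' := univ) (s' := fun b => univ.filter (fun a => R a b)) (by simp)]
  refine sum_congr rfl fun b _ => ?_
  rw [← mul_sum, ← sum_inner_sub_eq_half_sum_norm_sub_sq _ fun a => F a b (x a)]

/-- Let `R ⊆ A × B` be a finite relation (a hypergraph with node set `A` and nonempty
hyperedges `b ∈ B`), with finite-dimensional real inner product stalks `U a`, `W b` and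
restriction maps `F a b : U a →ₗ[ℝ] W b`, let `L` be the sheaf hypergraph Laplacian of
Duta et al. on `⊕_{a} U a`, and let
`Γ = {(x, y) : F a b (x a) = y b for all (a,b) ∈ R}` be the space of global sections.
Then (using any selection `sel` of, for each `b`, a node related to `b`) the map sending
`x ∈ ker L` to `(x, y)` — where `y b` is the common value `F a b (x a)` for any `a`
related to `b` — is a well-defined linear isomorphism from `ker L` onto `Γ`, whose
inverse is the restriction to `Γ` of the coordinate projection onto `⊕_{a} U a`. -/
theorem stmt13 {A B : Type*} [Fintype A] [Fintype B] [DecidableEq A]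
    (R : A → B → Prop) [∀ a b, Decidable (R a b)]
    (hB : ∀ b : B, ∃ a : A, R a b)
    (U : A → Type*) [∀ a, NormedAddCommGroup (U a)] [∀ a, InnerProductSpace ℝ (U a)]
    [∀ a, FiniteDimensional ℝ (U a)]
    (W : B → Type*) [∀ b, NormedAddCommGroup (W b)] [∀ b, InnerProductSpace ℝ (W b)]
    [∀ b, FiniteDimensional ℝ (W b)]
    (F : ∀ a b, U a →ₗ[ℝ] W b)
    (L : (∀ a, U a) → (∀ a, U a))
    (hL : ∀ (x : ∀ a, U a) (a : A), L x a =
      ∑ b ∈ univ.filter (fun b => R a b),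
        ((univ.filter (fun a' => R a' b)).card : ℝ)⁻¹ •
          (LinearMap.adjoint (F a b))
            (∑ a' ∈ univ.filter (fun a' => R a' b ∧ a' ≠ a),
              (F a b (x a) - F a' b (x a'))))
    (Γ : Set ((∀ a, U a) × (∀ b, W b)))
    (hΓ : Γ = {p : (∀ a, U a) × (∀ b, W b) |
      ∀ (a : A) (b : B), R a b → F a b (p.1 a) = p.2 b})
    (sel : B → A) (hsel : ∀ b, R (sel b) b) :
    (∀ x : ∀ a, U a, L x = 0 →
      ((x, fun b => F (sel b) b (x (sel b))) ∈ Γ)) ∧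
    (∀ p ∈ Γ, L p.1 = 0 ∧ (fun b => F (sel b) b (p.1 (sel b))) = p.2) := by
  subst hΓ
  refine ⟨fun x hx a b hab => ?_, fun p hp => ⟨?_, ?_⟩⟩
  · have henergy := sum_inner_sheafHypergraphLaplacian R U W F x
    simp only [← hL, hx, Pi.zero_apply, inner_zero_right, sum_const_zero] at henergy
    have hb := (sum_eq_zero_iff_of_nonneg fun b _ => by positivity).mp henergy.symm b (mem_univ b)
    have hcard : ((univ.filter (fun a => R a b)).card : ℝ)⁻¹ ≠ 0 :=
      inv_ne_zero (Nat.cast_ne_zero.mpr (card_ne_zero_of_mem (mem_filter.mpr ⟨mem_univ a, hab⟩)))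
    have hsum := (mul_eq_zero.mp ((mul_eq_zero.mp hb).resolve_left hcard)).resolve_left
      (by norm_num)
    have ha := (sum_eq_zero_iff_of_nonneg fun a _ => by positivity).mp hsum a (by simpa using hab)
    have hsq := (sum_eq_zero_iff_of_nonneg fun a' _ => by positivity).mp ha (sel b)
      (by simpa using hsel b)
    exact sub_eq_zero.mp (norm_eq_zero.mp (pow_eq_zero_iff two_ne_zero |>.mp hsq))
  · funext a
    rw [hL]
    refine sum_eq_zero fun b hb => ?_
    rw [sum_eq_zero, map_zero, smul_zero]
    intro a' ha'
    rw [hp a b (mem_filter.mp hb).2, hp a' b (mem_filter.mp ha').2.1, sub_self]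
  · funext b
    exact hp (sel b) b (hsel b)
end

section
/- Let A, B, C be finite-dimensional real inner product spaces and f : A → B, g : B → C linear maps with g ∘ f = 0, and let Δ := f ∘ f* + g* ∘ g : B → B be the Hodge Laplacian. Then B is the internal orthogonal direct sum of the three subspaces range f, ker Δ, and range g*: these subspaces are pairwise orthogonal and their sum is all of B (the Hodge decomposition). -/
open scoped RealInnerProductSpace

/-- The kernel of the Hodge Laplacian consists of the vectors annihilated by both `f*` and `g`. -/
theorem mem_ker_hodgeLaplacian_iff {A B C : Type*}
    [NormedAddCommGroup A] [InnerProductSpace ℝ A] [FiniteDimensional ℝ A]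
    [NormedAddCommGroup B] [InnerProductSpace ℝ B] [FiniteDimensional ℝ B]
    [NormedAddCommGroup C] [InnerProductSpace ℝ C] [FiniteDimensional ℝ C]
    (f : A →ₗ[ℝ] B) (g : B →ₗ[ℝ] C) (x : B) :
    x ∈ LinearMap.ker (f ∘ₗ LinearMap.adjoint f + LinearMap.adjoint g ∘ₗ g) ↔
      LinearMap.adjoint f x = 0 ∧ g x = 0 := by
  constructor
  · intro hx
    have h : ⟪LinearMap.adjoint f x, LinearMap.adjoint f x⟫ + ⟪g x, g x⟫ = 0 := by
      rw [← LinearMap.adjoint_inner_right g, LinearMap.adjoint_inner_left f, ← inner_add_right]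
      exact (congrArg (fun y => ⟪x, y⟫) (LinearMap.mem_ker.mp hx)).trans (inner_zero_right x)
    rwa [add_eq_zero_iff_of_nonneg real_inner_self_nonneg real_inner_self_nonneg,
      inner_self_eq_zero, inner_self_eq_zero] at h
  · rintro ⟨hf, hg⟩
    simp [hf, hg]

/-- Let `A, B, C` be finite-dimensional real inner product spaces, `f : A → B`,
`g : B → C` linear with `g ∘ f = 0`, and `Δ = f ∘ f* + g* ∘ g` the Hodge Laplacian
on `B`.  Then `B` is the internal orthogonal direct sum of `range f`, `ker Δ`, and
`range g*`: these subspaces are pairwise orthogonal and their sum is all of `B`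
(the Hodge decomposition). -/
theorem stmt15 {A B C : Type*}
    [NormedAddCommGroup A] [InnerProductSpace ℝ A] [FiniteDimensional ℝ A]
    [NormedAddCommGroup B] [InnerProductSpace ℝ B] [FiniteDimensional ℝ B]
    [NormedAddCommGroup C] [InnerProductSpace ℝ C] [FiniteDimensional ℝ C]
    (f : A →ₗ[ℝ] B) (g : B →ₗ[ℝ] C) (hgf : g ∘ₗ f = 0)
    (Δ : B →ₗ[ℝ] B)
    (hΔ : Δ = f ∘ₗ LinearMap.adjoint f + LinearMap.adjoint g ∘ₗ g) :
    (∀ x ∈ LinearMap.range f, ∀ y ∈ LinearMap.ker Δ, ⟪x, y⟫ = 0) ∧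
    (∀ x ∈ LinearMap.range f, ∀ y ∈ LinearMap.range (LinearMap.adjoint g), ⟪x, y⟫ = 0) ∧
    (∀ x ∈ LinearMap.ker Δ, ∀ y ∈ LinearMap.range (LinearMap.adjoint g), ⟪x, y⟫ = 0) ∧
    (LinearMap.range f ⊔ LinearMap.ker Δ ⊔ LinearMap.range (LinearMap.adjoint g) = ⊤) := by
  subst hΔ
  refine ⟨?_, ?_, ?_, ?_⟩
  · rintro _ ⟨a, rfl⟩ y hy
    rw [← LinearMap.adjoint_inner_right, ((mem_ker_hodgeLaplacian_iff f g y).mp hy).1,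
      inner_zero_right]
  · rintro _ ⟨a, rfl⟩ _ ⟨c, rfl⟩
    rw [LinearMap.adjoint_inner_right, ← LinearMap.comp_apply, hgf, LinearMap.zero_apply,
      inner_zero_left]
  · rintro x hx _ ⟨c, rfl⟩
    rw [LinearMap.adjoint_inner_right, ((mem_ker_hodgeLaplacian_iff f g x).mp hx).2,
      inner_zero_left]
  · rw [← Submodule.orthogonal_eq_bot_iff, Submodule.eq_bot_iff]
    intro x hx
    simp only [← Submodule.inf_orthogonal, Submodule.mem_inf, LinearMap.orthogonal_range,
      LinearMap.adjoint_adjoint, LinearMap.mem_ker (f := g),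
      LinearMap.mem_ker (f := LinearMap.adjoint f)] at hx
    obtain ⟨⟨hf, h_ker⟩, hg⟩ := hx
    exact inner_self_eq_zero.mp
      ((Submodule.mem_orthogonal _ x).mp h_ker x ((mem_ker_hodgeLaplacian_iff f g x).mpr ⟨hf, hg⟩))
end

section
/- Let A, B, C be finite-dimensional real inner product spaces and f : A → B, g : B → C linear maps with g ∘ f = 0, and let Δ := f ∘ f* + g* ∘ g : B → B be the Hodge Laplacian. Since range f ⊆ ker g, the cohomology H := ker g / range f is defined, and the composite of the inclusion ker Δ ↪ ker g with the quotient map ker g → H is a linear isomorphism ker Δ ≅ H; that is, every cohomology class has a unique harmonic representative. -/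
/-- The kernel of the Hodge Laplacian `f ∘ f* + g* ∘ g` consists of the vectors which are both
closed and coclosed. -/
theorem LinearMap.ker_comp_adjoint_add_adjoint_comp {A B C : Type*}
    [NormedAddCommGroup A] [InnerProductSpace ℝ A] [FiniteDimensional ℝ A]
    [NormedAddCommGroup B] [InnerProductSpace ℝ B] [FiniteDimensional ℝ B]
    [NormedAddCommGroup C] [InnerProductSpace ℝ C] [FiniteDimensional ℝ C]
    (f : A →ₗ[ℝ] B) (g : B →ₗ[ℝ] C) :
    LinearMap.ker (f ∘ₗ LinearMap.adjoint f + LinearMap.adjoint g ∘ₗ g) =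
      LinearMap.ker (LinearMap.adjoint f) ⊓ LinearMap.ker g := by
  ext x
  simp only [Submodule.mem_inf, LinearMap.mem_ker, LinearMap.add_apply, LinearMap.comp_apply]
  refine ⟨fun hx => ?_, fun ⟨hf, hg⟩ => by simp [hf, hg]⟩
  have key : ‖LinearMap.adjoint f x‖ ^ 2 + ‖g x‖ ^ 2 = 0 := by
    rw [← real_inner_self_eq_norm_sq, ← real_inner_self_eq_norm_sq,
      LinearMap.adjoint_inner_left, ← LinearMap.adjoint_inner_right g, ← inner_add_right, hx,
      inner_zero_right]
  constructor
  · exact norm_eq_zero.1 (by nlinarith [sq_nonneg ‖LinearMap.adjoint f x‖, sq_nonneg ‖g x‖])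
  · exact norm_eq_zero.1 (by nlinarith [sq_nonneg ‖LinearMap.adjoint f x‖, sq_nonneg ‖g x‖])

/-- Let `A, B, C` be finite-dimensional real inner product spaces, `f : A → B`,
`g : B → C` linear with `g ∘ f = 0`, and `Δ = f ∘ f* + g* ∘ g` the Hodge Laplacian
on `B`.  Since `range f ⊆ ker g`, the cohomology `H = ker g ⧸ range f` is defined
(as the quotient of `ker g` by the submodule of `ker g` induced by `range f`), and
the composite of the inclusion `ker Δ ↪ ker g` with the quotient map `ker g → H` is
a linear isomorphism `ker Δ ≅ H`: every cohomology class has a unique harmonic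
representative. -/
theorem stmt16 {A B C : Type*}
    [NormedAddCommGroup A] [InnerProductSpace ℝ A] [FiniteDimensional ℝ A]
    [NormedAddCommGroup B] [InnerProductSpace ℝ B] [FiniteDimensional ℝ B]
    [NormedAddCommGroup C] [InnerProductSpace ℝ C] [FiniteDimensional ℝ C]
    (f : A →ₗ[ℝ] B) (g : B →ₗ[ℝ] C) (hgf : g ∘ₗ f = 0)
    (Δ : B →ₗ[ℝ] B)
    (hΔ : Δ = f ∘ₗ LinearMap.adjoint f + LinearMap.adjoint g ∘ₗ g) :
    ∃ h : LinearMap.ker Δ ≤ LinearMap.ker g,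
      Function.Bijective
        ⇑(((LinearMap.range f).comap (LinearMap.ker g).subtype).mkQ ∘ₗ
          Submodule.inclusion h) := by
  subst hΔ
  have hker := LinearMap.ker_comp_adjoint_add_adjoint_comp f g
  have horth : (LinearMap.range f)ᗮ = LinearMap.ker (LinearMap.adjoint f) :=
    LinearMap.orthogonal_range f
  refine ⟨hker.trans_le inf_le_right, ?_, ?_⟩
  · rw [← LinearMap.ker_eq_bot, LinearMap.ker_eq_bot']
    rintro ⟨x, hx⟩ h
    have hxf : x ∈ LinearMap.range f := by
      simpa using h
    rw [hker, ← horth] at hx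
    have : x = 0 := inner_self_eq_zero.1 (hx.1 x hxf)
    simpa using this
  · intro y
    obtain ⟨⟨x, hx⟩, rfl⟩ := Submodule.mkQ_surjective _ y
    obtain ⟨p, hp, q, hq, rfl⟩ := (LinearMap.range f).exists_add_mem_mem_orthogonal x
    have hgp : g p = 0 := by
      obtain ⟨a, rfl⟩ := hp
      exact LinearMap.congr_fun hgf a
    have hgq : g q = 0 := by simpa [hgp] using hx
    refine ⟨⟨q, hker ▸ ⟨horth ▸ hq, hgq⟩⟩, ?_⟩
    refine (Submodule.Quotient.eq _).2 ?_
    simpa using hp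
end
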